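/- Let X be a finite subset of ℝ^n and k ≥ 0 an integer. For all a, b, c ∈ Γ_k(X): if a ≼ b and a ≼ c, then b ≼ c or c ≼ b. (The set of elements above any element of Γ_k(X) is totally ordered, so Γ_k(X) is a tree.) -/

import Mathlib

open scoped Classical

noncomputable section

namespace DataHomotopy

/-- Points of `ℝ^n` with the Euclidean metric. -/
abbrev Pt (n : ℕ) := EuclideanSpace ℝ (Fin n)

/-- `σ` is a simplex of the Vietoris–Rips complex `V_s(X)`: a nonempty subset of `X`
all of whose pairwise distances are at most `s`. -/
def IsVRSimplex {n : ℕ} (X : Finset (Pt n)) (s : ℝ) (σ : Finset (Pt n)) : Prop :=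
  σ.Nonempty ∧ σ ⊆ X ∧ ∀ x ∈ σ, ∀ y ∈ σ, dist x y ≤ s

/-- `x` is a vertex of the Lesnick complex `L_{s,k}(X)`: `x ∈ X` and there are at least
`k` points of `X`, distinct from `x`, within distance `s` of `x`. -/
def IsLVertex {n : ℕ} (X : Finset (Pt n)) (k : ℕ) (s : ℝ) (x : Pt n) : Prop :=
  x ∈ X ∧ ∃ S : Finset (Pt n), S ⊆ X ∧ x ∉ S ∧ k ≤ S.card ∧ ∀ x' ∈ S, dist x x' ≤ s

/-- `σ` is a simplex of the Lesnick complex `L_{s,k}(X)`: a Vietoris–Rips simplex all of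
whose elements are vertices of `L_{s,k}(X)`. -/
def IsLSimplex {n : ℕ} (X : Finset (Pt n)) (k : ℕ) (s : ℝ) (σ : Finset (Pt n)) : Prop :=
  IsVRSimplex X s σ ∧ ∀ x ∈ σ, IsLVertex X k s x

/-- `x` and `y` lie in the same component of `L_{s,k}(X)`: both are vertices, and they are
joined by a finite chain of vertices with consecutive distances at most `s`. -/
def SameComp {n : ℕ} (X : Finset (Pt n)) (k : ℕ) (s : ℝ) (x y : Pt n) : Prop :=
  IsLVertex X k s x ∧
    Relation.ReflTransGen (fun a b => IsLVertex X k s b ∧ dist a b ≤ s) x y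

/-- `p = (s, x)` is an element of `Γ_k(X)`: `s ≥ 0` and `x` is a vertex of `L_{s,k}(X)`. -/
def InGamma {n : ℕ} (X : Finset (Pt n)) (k : ℕ) (p : ℝ × Pt n) : Prop :=
  0 ≤ p.1 ∧ IsLVertex X k p.1 p.2

/-- The preorder on `Γ_k(X)`: `(s, x) ≼ (t, y)` iff `s ≤ t` and `x`, `y` lie in the same
component of `L_{t,k}(X)`. -/
def GammaLe {n : ℕ} (X : Finset (Pt n)) (k : ℕ) (p q : ℝ × Pt n) : Prop :=
  p.1 ≤ q.1 ∧ SameComp X k q.1 p.2 q.2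

/-- `p = (t, x)` is a branch point of `Γ_k(X)`. -/
def IsBranch {n : ℕ} (X : Finset (Pt n)) (k : ℕ) (p : ℝ × Pt n) : Prop :=
  InGamma X k p ∧
    ((∃ s₀, s₀ < p.1 ∧ ∀ s, s₀ ≤ s → s < p.1 →
        ∃ x₀ x₁ : Pt n, IsLVertex X k s x₀ ∧ IsLVertex X k s x₁ ∧
          ¬ SameComp X k s x₀ x₁ ∧ GammaLe X k (s, x₀) p ∧ GammaLe X k (s, x₁) p) ∨
      ¬ ∃ q : ℝ × Pt n, q.1 < p.1 ∧ InGamma X k q ∧ GammaLe X k q p)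

/-- `c` is a least upper bound of `a` and `b` in `Γ_k(X)`. -/
def IsLUBIn {n : ℕ} (X : Finset (Pt n)) (k : ℕ) (a b c : ℝ × Pt n) : Prop :=
  InGamma X k c ∧ GammaLe X k a c ∧ GammaLe X k b c ∧
    ∀ c', InGamma X k c' → GammaLe X k a c' → GammaLe X k b c' → GammaLe X k c c'

/-- `b` is a maximal branch point below `a` in `Γ_k(X)`. -/
def IsMaxBranchBelow {n : ℕ} (X : Finset (Pt n)) (k : ℕ) (b a : ℝ × Pt n) : Prop :=
  IsBranch X k b ∧ GammaLe X k b a ∧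
    ∀ b', IsBranch X k b' → GammaLe X k b' a → GammaLe X k b' b

/-- The Euclidean distance on `(ℝ^n)^m ≅ ℝ^{nm}` between two `m`-tuples. -/
def tupleDist {n m : ℕ} (y x : Fin m → Pt n) : ℝ :=
  Real.sqrt (∑ i, dist (y i) (x i) ^ 2)

/-- `X^m_dis` is `r`-dense in `Y^m_dis`: every `m`-tuple of pairwise distinct points of `Y`
is within distance `< r` (in `ℝ^{nm}`) of an `m`-tuple of pairwise distinct points of `X`. -/
def ConfigDense {n : ℕ} (X Y : Finset (Pt n)) (m : ℕ) (r : ℝ) : Prop :=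
  ∀ y : Fin m → Pt n, (∀ i, y i ∈ Y) → Function.Injective y →
    ∃ x : Fin m → Pt n, (∀ i, x i ∈ X) ∧ Function.Injective x ∧ tupleDist y x < r

/-- `s` and `t` are consecutive phase-change numbers of `Y`: both are realized as distances
between points of `Y`, `s < t`, and no distance between points of `Y` lies strictly
between `s` and `t`. -/
def IsPhasePair {n : ℕ} (Y : Finset (Pt n)) (s t : ℝ) : Prop :=
  (∃ a ∈ Y, ∃ b ∈ Y, dist a b = s) ∧ (∃ a ∈ Y, ∃ b ∈ Y, dist a b = t) ∧
    s < t ∧ ∀ a ∈ Y, ∀ b ∈ Y, dist a b ≤ s ∨ t ≤ dist a b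

/-- `dS X k s x y = u - s`, where `u` is the least number `u ≥ s` such that `x` and `y`
lie in the same component of `L_{u,k}(X)`. -/
def dS {n : ℕ} (X : Finset (Pt n)) (k : ℕ) (s : ℝ) (x y : Pt n) : ℝ :=
  sInf {u : ℝ | s ≤ u ∧ SameComp X k u x y} - s

theorem IsLVertex.mono {n : ℕ} {X : Finset (Pt n)} {k : ℕ} {s t : ℝ} {x : Pt n}
    (h : IsLVertex X k s x) (hst : s ≤ t) : IsLVertex X k t x := by
  obtain ⟨hx, S, hS, hxS, hk, hd⟩ := h
  exact ⟨hx, S, hS, hxS, hk, fun x' hx' => (hd x' hx').trans hst⟩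

theorem SameComp.mono {n : ℕ} {X : Finset (Pt n)} {k : ℕ} {s t : ℝ} {x y : Pt n}
    (h : SameComp X k s x y) (hst : s ≤ t) : SameComp X k t x y :=
  ⟨h.1.mono hst, Relation.ReflTransGen.mono
    (fun _ _ hab => ⟨hab.1.mono hst, hab.2.trans hst⟩) _ _ h.2⟩

theorem SameComp.symm {n : ℕ} {X : Finset (Pt n)} {k : ℕ} {s : ℝ} {x y : Pt n}
    (h : SameComp X k s x y) : SameComp X k s y x := by
  obtain ⟨hx, hxy⟩ := h
  induction hxy with
  | refl => exact ⟨hx, .refl⟩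
  | tail _ hbc ih => exact ⟨hbc.1, ih.2.head ⟨ih.1, (dist_comm _ _).trans_le hbc.2⟩⟩

theorem SameComp.trans {n : ℕ} {X : Finset (Pt n)} {k : ℕ} {s : ℝ} {x y z : Pt n}
    (hxy : SameComp X k s x y) (hyz : SameComp X k s y z) : SameComp X k s x z :=
  ⟨hxy.1, hxy.2.trans hyz.2⟩

theorem stmt7 {n : ℕ} (X : Finset (Pt n)) (k : ℕ) (a b c : ℝ × Pt n)
    (ha : InGamma X k a) (hb : InGamma X k b) (hc : InGamma X k c)
    (hab : GammaLe X k a b) (hac : GammaLe X k a c) :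
    GammaLe X k b c ∨ GammaLe X k c b := by
  rcases le_total b.1 c.1 with h | h
  · exact .inl ⟨h, (hab.2.mono h).symm.trans hac.2⟩
  · exact .inr ⟨h, (hac.2.mono h).symm.trans hab.2⟩

end DataHomotopy
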